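/- Let d ≥ 2, α ∈ (1,2], β ∈ (1,d], and let p, r satisfy hypothesis (H2): either max{2d/(d+β−1), d/(α+β−2)} < p ≤ d/(β−1) and max{p, p/(p−1), d/(α−1)} < r < pd/(d−p(β−1)), or p > d/(β−1) and r > max{p, p/(p−1), d/(α−1)}; and assume p < dα/(2β(α−1)−α) whenever 2β(α−1) − α ≥ 0. Set σ = 2 − (1/α)(d/r + 1) − (d/β)(1/p − 1/r) − 1/β and p₁ = pd/(ασp + d). Then 1 ≤ p₁ < p. -/

import Mathlib

/-- Hypothesis (H2) on the exponents `p, r`. -/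
def H2strict (d α β p r : ℝ) : Prop :=
  (max (2 * d / (d + β - 1)) (d / (α + β - 2)) < p ∧ p ≤ d / (β - 1) ∧
    max (max p (p / (p - 1))) (d / (α - 1)) < r ∧ r < p * d / (d - p * (β - 1))) ∨
  (d / (β - 1) < p ∧ max (max p (p / (p - 1))) (d / (α - 1)) < r)

/-- With `σ = 2 − (1/α)(d/r+1) − (d/β)(1/p−1/r) − 1/β` and `p₁ = pd/(ασp + d)` one has
`1 ≤ p₁ < p`. -/
theorem p1_range
    (d : ℕ) (hd : 2 ≤ d) (α β p r σ p₁ : ℝ)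
    (hα : α ∈ Set.Ioc (1:ℝ) 2) (hβ : β ∈ Set.Ioc (1:ℝ) (d:ℝ))
    (hpr : H2strict (d:ℝ) α β p r)
    (hextra : 0 ≤ 2 * β * (α - 1) - α → p < (d:ℝ) * α / (2 * β * (α - 1) - α))
    (hσ : σ = 2 - (1/α) * ((d:ℝ)/r + 1) - ((d:ℝ)/β) * (1/p - 1/r) - 1/β)
    (hp₁ : p₁ = p * (d:ℝ) / (α * σ * p + (d:ℝ))) :
    1 ≤ p₁ ∧ p₁ < p := by
  obtain ⟨hα1, hα2⟩ := hα
  obtain ⟨hβ1, hβ2⟩ := hβ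
  have hd' : (2:ℝ) ≤ (d:ℝ) := by exact_mod_cast hd
  generalize (d:ℝ) = D at *
  have hD : 0 < D := by linarith
  have hb : 0 < β - 1 := by linarith
  have key : 1 < p ∧ p < r ∧ D / (α - 1) < r ∧ D * (1/p - 1/r) < β - 1 := by
    rcases hpr with ⟨h1, h2, h3, h4⟩ | ⟨h1, h3⟩
    · simp only [max_lt_iff] at h1 h3
      obtain ⟨h1, -⟩ := h1
      obtain ⟨⟨hpr, -⟩, hr⟩ := h3
      have hp : 1 < p := by
        refine lt_trans ?_ h1
        rw [lt_div_iff₀ (by linarith)]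
        linarith
      refine ⟨hp, hpr, hr, ?_⟩
      have hp0 : 0 < p := by linarith
      have hr0 : 0 < r := by linarith
      rw [le_div_iff₀ hb] at h2
      rcases h2.lt_or_eq with h | h
      · rw [lt_div_iff₀ (by linarith)] at h4
        have e : D * (1/p - 1/r) = (D * r - D * p) / (p * r) := by field_simp
        rw [e, div_lt_iff₀ (by positivity)]
        linarith
      · rw [h, sub_self, div_zero] at h4
        linarith
    · simp only [max_lt_iff] at h3
      obtain ⟨⟨hpr, -⟩, hr⟩ := h3
      have hp : 1 < p := by
        refine lt_trans ?_ h1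
        rw [lt_div_iff₀ hb]
        linarith
      refine ⟨hp, hpr, hr, ?_⟩
      have hp0 : 0 < p := by linarith
      have hr0 : 0 < r := by linarith
      rw [div_lt_iff₀ hb] at h1
      have h5 : D / p < β - 1 := by
        rw [div_lt_iff₀ hp0]; linarith
      have h6 : 0 < D / r := by positivity
      have e : D * (1/p - 1/r) = D / p - D / r := by ring
      linarith
  obtain ⟨hp, hpr, hr, hz⟩ := key
  have hp0 : 0 < p := by linarith
  have hr0 : 0 < r := by linarith
  have hy : D / r < α - 1 := by
    rw [div_lt_iff₀ (by linarith)] at hr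
    rw [div_lt_iff₀ hr0]; linarith
  have hz0 : 0 < D * (1/p - 1/r) := by
    have := one_div_lt_one_div_of_lt hp0 hpr
    exact mul_pos hD (by linarith)
  have hα0 : 0 < α := by linarith
  have hβ0 : 0 < β := by linarith
  have hσ0 : 0 < σ := by
    have e : σ = (α - 1 - D / r) / α + (β - 1 - D * (1/p - 1/r)) / β := by
      rw [hσ]; field_simp; ring
    rw [e]
    have := div_pos (sub_pos.2 hy) hα0
    have := div_pos (sub_pos.2 hz) hβ0
    linarith
  have hden : 0 < α * σ * p + D := by positivity
  have hub : α * σ + D / p ≤ D := by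
    have e : α * σ + D / p = 2 * α - 1 - α / β + (1 - α / β) * (D * (1/p - 1/r)) := by
      rw [hσ]; field_simp; ring
    rw [e]
    rcases le_total α β with h | h
    · have h1 : α / β ≤ 1 := (div_le_one hβ0).2 h
      have h2 := mul_le_mul_of_nonneg_left hz.le (sub_nonneg.2 h1)
      have e2 : 2 * α - 1 - α / β + (1 - α / β) * (β - 1) = α + β - 2 := by
        field_simp; ring
      linarith
    · have h1 : 1 ≤ α / β := (one_le_div hβ0).2 h
      have h2 := mul_nonneg (sub_nonneg.2 h1) hz0.le
      linarith
  rw [hp₁]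
  constructor
  · rw [le_div_iff₀ hden]
    have h1 := mul_le_mul_of_nonneg_right hub hp0.le
    have e : (α * σ + D / p) * p = α * σ * p + D := by field_simp
    linarith
  · rw [div_lt_iff₀ hden]
    have : 0 < p * (α * σ * p) := by positivity
    linarith
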